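/- For every permutation w, the coefficient of the monomial x^{code(w)} in the Schubert polynomial 𝔖_w is nonzero (in fact equals 1). -/

import Mathlib

open Finset MvPolynomial

/-- The code of `w`: `c_i(w) = #{j > i : w(j) < w(i)}`. -/
def code {n : ℕ} (w : Equiv.Perm (Fin n)) (i : Fin n) : ℕ :=
  (univ.filter fun j : Fin n => i < j ∧ w j < w i).card

/-- `S` is the family of Schubert polynomials (0-indexed variables `x_0,…`):
`S w₀ = x_0^{n-1} x_1^{n-2} ⋯ x_{n-2}` for the longest element `w₀`, and
`S w = ∂_i S_{w sᵢ}` whenever `w(i) < w(i+1)`, where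
`∂_i f = (f - sᵢ·f)/(x_i - x_{i+1})`, i.e. `(x_i - x_{i+1})·(∂_i f) = f - sᵢ·f`. -/
def IsSchubertFamily {n : ℕ} (S : Equiv.Perm (Fin n) → MvPolynomial (Fin n) ℤ) : Prop :=
  (∀ w0 : Equiv.Perm (Fin n), (∀ i : Fin n, (w0 i : ℕ) = n - 1 - (i : ℕ)) →
      S w0 = ∏ i : Fin n, X i ^ (n - 1 - (i : ℕ))) ∧
  (∀ (w : Equiv.Perm (Fin n)) (i i' : Fin n), (i : ℕ) + 1 = (i' : ℕ) → w i < w i' →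
      (X i - X i') * S w
        = S (w * Equiv.swap i i')
          - rename (Equiv.swap i i') (S (w * Equiv.swap i i')))

section helpers

variable {n : ℕ}

/-- Without ascents after position `p`, the value at `p` exceeds all later ones. -/
theorem lt_of_no_ascent (w : Equiv.Perm (Fin n)) (p : Fin n)
    (h : ∀ i i' : Fin n, p < i' → (i : ℕ) + 1 = (i' : ℕ) → ¬ w i < w i') :
    ∀ j : Fin n, p < j → w j < w p := by
  have key : ∀ m : ℕ, (p : ℕ) + 1 ≤ m → ∀ hm : m < n, w ⟨m, hm⟩ < w p := by
    intro m hm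
    induction m, hm using Nat.le_induction with
    | base =>
      intro hm
      have h1 := h p ⟨p + 1, hm⟩ (by simp [Fin.lt_def]) rfl
      have h2 : w ⟨p + 1, hm⟩ ≠ w p := by
        intro h3
        have := congrArg Fin.val (w.injective h3)
        simp at this
      exact lt_of_le_of_ne (not_lt.mp h1) h2
    | succ m hpm ih =>
      intro hm
      have h0 := ih (by omega)
      have h1 := h ⟨m, by omega⟩ ⟨m + 1, hm⟩ (by simp only [Fin.lt_def]; omega) rfl
      exact lt_of_le_of_lt (not_lt.mp h1) h0
  intro j hj
  exact key j hj j.2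

/-- Either `w` is decreasing, or it has a last ascent. -/
theorem decreasing_or_last_ascent (w : Equiv.Perm (Fin n)) :
    (∀ i j : Fin n, i < j → w j < w i) ∨
    ∃ i i' : Fin n, (i : ℕ) + 1 = (i' : ℕ) ∧ w i < w i' ∧ ∀ j, i' < j → w j < w i' := by
  classical
  set A := univ.filter fun p : Fin n => ∃ i : Fin n, (i : ℕ) + 1 = (p : ℕ) ∧ w i < w p with hA
  rcases A.eq_empty_or_nonempty with h | h
  · left
    intro i j hij
    refine lt_of_no_ascent w i (fun a b _ hab hlt => ?_) j hij
    have : b ∈ A := by simp only [hA, mem_filter, mem_univ, true_and]; exact ⟨a, hab, hlt⟩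
    simp [h] at this
  · right
    have hm := A.max'_mem h
    obtain ⟨i, hi, hlt⟩ := (mem_filter.mp hm).2
    refine ⟨i, A.max' h, hi, hlt, lt_of_no_ascent w _ (fun a b hb hab hlt' => ?_)⟩
    have : b ∈ A := by simp only [hA, mem_filter, mem_univ, true_and]; exact ⟨a, hab, hlt'⟩
    exact absurd (A.le_max' b this) (not_le.mpr hb)

theorem val_of_decreasing (w : Equiv.Perm (Fin n)) (h : ∀ i j : Fin n, i < j → w j < w i)
    (i : Fin n) : (w i : ℕ) = n - 1 - (i : ℕ) := by
  have h1 : StrictMono (fun i => Fin.rev (w i)) := fun a b hab => Fin.rev_lt_rev.mpr (h a b hab)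
  have h2 : (fun i => Fin.rev (w i)) = id := by
    refine (h1.range_inj strictMono_id).mp ?_
    rw [Set.range_id]
    exact (Fin.rev_surjective.comp w.surjective).range_eq
  have h3 := congrArg Fin.val (congrFun h2 i)
  simp only [Fin.val_rev, id] at h3
  have := (w i).2
  omega

theorem code_of_dominating (w : Equiv.Perm (Fin n)) (i : Fin n) (h : ∀ j, i < j → w j < w i) :
    code w i = n - 1 - (i : ℕ) := by
  unfold code
  rw [← Fin.card_Ioi i]
  congr 1
  ext j
  simp only [mem_filter, mem_univ, true_and, mem_Ioi]
  exact ⟨fun h => h.1, fun hj => ⟨hj, h j hj⟩⟩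

theorem code_swap_other (w : Equiv.Perm (Fin n)) (i i' k : Fin n) (hi : (i : ℕ) + 1 = (i' : ℕ))
    (hk : k ≠ i) (hk' : k ≠ i') : code (w * Equiv.swap i i') k = code w k := by
  unfold code
  apply Finset.card_equiv (Equiv.swap i i')
  intro j
  have hlt : k < j ↔ k < Equiv.swap i i' j := by
    have := Fin.val_ne_of_ne hk
    have := Fin.val_ne_of_ne hk'
    rw [Equiv.swap_apply_def]
    split_ifs with h1 h2
    · subst h1; simp only [Fin.lt_def]; omega
    · subst h2; simp only [Fin.lt_def]; omega
    · rfl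
  simp only [mem_filter, mem_univ, true_and, Equiv.Perm.mul_apply,
    Equiv.swap_apply_of_ne_of_ne hk hk', hlt]

theorem code_swap_right (w : Equiv.Perm (Fin n)) (i i' : Fin n) (hi : (i : ℕ) + 1 = (i' : ℕ))
    (h : w i < w i') : code (w * Equiv.swap i i') i' = code w i := by
  unfold code
  congr 1
  ext j
  simp only [mem_filter, mem_univ, true_and, Equiv.Perm.mul_apply, Equiv.swap_apply_right]
  by_cases h1 : j = i
  · subst h1
    have h3 : ¬ i' < j := by simp only [Fin.lt_def]; omega
    simp [h3]
  by_cases h2 : j = i'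
  · subst h2; simp [h.le]
  rw [Equiv.swap_apply_of_ne_of_ne h1 h2]
  have := Fin.val_ne_of_ne h1
  have := Fin.val_ne_of_ne h2
  simp only [Fin.lt_def]
  omega

theorem measure_lt (w : Equiv.Perm (Fin n)) (i i' : Fin n) (hi : (i : ℕ) + 1 = (i' : ℕ))
    (h : w i < w i') :
    ∑ j : Fin n, (j : ℕ) * ((w * Equiv.swap i i') j : ℕ) < ∑ j : Fin n, (j : ℕ) * (w j : ℕ) := by
  have hne : i ≠ i' := by rintro rfl; omega
  have hm : i' ∈ univ.erase i := by simp [hne.symm]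
  rw [← Finset.add_sum_erase _ _ (mem_univ i), ← Finset.add_sum_erase _ _ hm,
    ← Finset.add_sum_erase univ (fun j : Fin n => (j : ℕ) * (w j : ℕ)) (mem_univ i),
    ← Finset.add_sum_erase _ (fun j : Fin n => (j : ℕ) * (w j : ℕ)) hm]
  have : ∑ j ∈ (univ.erase i).erase i', (j : ℕ) * ((w * Equiv.swap i i') j : ℕ)
      = ∑ j ∈ (univ.erase i).erase i', (j : ℕ) * (w j : ℕ) := by
    apply Finset.sum_congr rfl
    intro j hj
    simp only [mem_erase, mem_univ, and_true] at hj
    rw [Equiv.Perm.mul_apply, Equiv.swap_apply_of_ne_of_ne hj.2 hj.1]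
  rw [this]
  simp only [Equiv.Perm.mul_apply, Equiv.swap_apply_left, Equiv.swap_apply_right]
  rw [← hi]
  have : (w i : ℕ) < w i' := h
  nlinarith

theorem degreeOf_swap (f : MvPolynomial (Fin n) ℤ) (i i' k : Fin n) :
    degreeOf k (rename (Equiv.swap i i') f) = degreeOf (Equiv.swap i i' k) f := by
  have := degreeOf_rename_of_injective (p := f) (Equiv.swap i i').injective (Equiv.swap i i' k)
  simpa using this

theorem degreeOf_X_sub_X {i i' : Fin n} (h : i ≠ i') :
    1 ≤ degreeOf i (X i - X i' : MvPolynomial (Fin n) ℤ) ∧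
    1 ≤ degreeOf i' (X i - X i' : MvPolynomial (Fin n) ℤ) := by
  constructor
  · have hc : (Finsupp.single i 1) ∈ (X i - X i' : MvPolynomial (Fin n) ℤ).support := by
      simp [mem_support_iff, coeff_X, Finsupp.single_left_inj, h.symm]
    simpa using degreeOf_le_iff.mp (le_refl (degreeOf i _)) _ hc
  · have hc : (Finsupp.single i' 1) ∈ (X i - X i' : MvPolynomial (Fin n) ℤ).support := by
      simp [mem_support_iff, coeff_X, Finsupp.single_left_inj, h]
    simpa using degreeOf_le_iff.mp (le_refl (degreeOf i' _)) _ hc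

/-- Divided differences preserve the staircase bound. -/
theorem staircase_step (f g : MvPolynomial (Fin n) ℤ) (i i' : Fin n) (hi : (i : ℕ) + 1 = (i' : ℕ))
    (hfg : (X i - X i') * g = f - rename (Equiv.swap i i') f)
    (hf : ∀ k : Fin n, degreeOf k f ≤ n - 1 - (k : ℕ)) (k : Fin n) :
    degreeOf k g ≤ n - 1 - (k : ℕ) := by
  have hne : i ≠ i' := by rintro rfl; omega
  by_cases hg : g = 0
  · simp [hg]
  have hX : (X i - X i' : MvPolynomial (Fin n) ℤ) ≠ 0 := by
    intro h0
    have := (degreeOf_X_sub_X hne).1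
    rw [h0] at this
    simp at this
  have h1 : degreeOf k (X i - X i' : MvPolynomial (Fin n) ℤ) + degreeOf k g
      ≤ max (degreeOf k f) (degreeOf (Equiv.swap i i' k) f) := by
    rw [← degreeOf_mul_eq hX hg, hfg, ← degreeOf_swap]
    exact degreeOf_sub_le _ _ _
  have hdi := hf i
  have hdi' := hf i'
  have hi'n := i'.2
  obtain ⟨d1, d2⟩ := degreeOf_X_sub_X hne
  by_cases hk : k = i
  · subst hk
    rw [Equiv.swap_apply_left] at h1
    omega
  by_cases hk' : k = i'
  · subst hk'
    rw [Equiv.swap_apply_right] at h1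
    omega
  rw [Equiv.swap_apply_of_ne_of_ne hk hk'] at h1
  have := hf k
  omega

theorem coeff_eq_zero_of_lt (f : MvPolynomial (Fin n) ℤ) (k : Fin n) (m : Fin n →₀ ℕ)
    (h : degreeOf k f < m k) : coeff m f = 0 := by
  by_contra hc
  have := degreeOf_le_iff.mp (le_refl (degreeOf k f)) m (mem_support_iff.mpr hc)
  omega

theorem main_aux (S : Equiv.Perm (Fin n) → MvPolynomial (Fin n) ℤ) (hS : IsSchubertFamily S)
    (N : ℕ) : ∀ w : Equiv.Perm (Fin n), ∑ j : Fin n, (j : ℕ) * (w j : ℕ) = N →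
      (∀ k : Fin n, degreeOf k (S w) ≤ n - 1 - (k : ℕ)) ∧
      coeff (Finsupp.equivFunOnFinite.symm (code w)) (S w) = 1 := by
  induction N using Nat.strong_induction_on with
  | _ N ih =>
  intro w hw
  rcases decreasing_or_last_ascent w with h | ⟨i, i', hi, hlt, hdom⟩
  · have hcode : code w = fun i : Fin n => n - 1 - (i : ℕ) :=
      funext fun i => code_of_dominating w i (h i)
    have hmon : S w = monomial (Finsupp.equivFunOnFinite.symm (code w)) 1 := by
      rw [hS.1 w (val_of_decreasing w h), monomial_eq, hcode, Finsupp.prod_fintype _ _ (by simp)]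
      simp
    constructor
    · intro k
      rw [hmon, degreeOf_monomial_eq _ _ one_ne_zero]
      simp [hcode]
    · rw [hmon, coeff_monomial, if_pos rfl]
  · have hne : i ≠ i' := by rintro rfl; omega
    have hi'n := i'.2
    obtain ⟨hf, hc⟩ := ih _ (hw ▸ measure_lt w i i' hi hlt) (w * Equiv.swap i i') rfl
    have hfg := hS.2 w i i' hi hlt
    have hg := staircase_step _ _ i i' hi hfg hf
    refine ⟨hg, ?_⟩
    set c : Fin n →₀ ℕ := Finsupp.equivFunOnFinite.symm (code w) with hcdef
    have hci' : c i' = n - 1 - (i' : ℕ) := code_of_dominating w i' hdom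
    set m : Fin n →₀ ℕ := Finsupp.single i' 1 + c with hm
    have hmi' : m i' = n - 1 - (i : ℕ) := by
      simp only [hm, Finsupp.add_apply, Finsupp.single_eq_same, hci']
      omega
    have hv : Finsupp.equivFunOnFinite.symm (code (w * Equiv.swap i i'))
        = m.mapDomain (Equiv.swap i i') := by
      ext k
      rw [← Finsupp.equivMapDomain_eq_mapDomain, Finsupp.equivMapDomain_apply, Equiv.symm_swap]
      change code (w * Equiv.swap i i') k = _
      by_cases hk : k = i
      · subst hk
        rw [Equiv.swap_apply_left, hmi']
        apply code_of_dominating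
        intro j hj
        rw [Equiv.Perm.mul_apply, Equiv.Perm.mul_apply, Equiv.swap_apply_left]
        by_cases hj' : j = i'
        · subst hj'; simpa using hlt
        rw [Equiv.swap_apply_of_ne_of_ne hj.ne' hj']
        apply hdom
        have := Fin.val_ne_of_ne hj'
        simp only [Fin.lt_def] at hj ⊢
        omega
      by_cases hk' : k = i'
      · subst hk'
        rw [Equiv.swap_apply_right, code_swap_right w i k hi hlt]
        simp [hm, hcdef, hne]
      · rw [Equiv.swap_apply_of_ne_of_ne hk hk', code_swap_other w i i' k hi hk hk']
        simp [hm, hcdef, hk']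
    rw [hv] at hc
    have hE := congrArg (coeff m) hfg
    have z1 : coeff m (S (w * Equiv.swap i i')) = 0 := by
      apply coeff_eq_zero_of_lt _ i'
      have := hf i'
      omega
    have z2 : coeff m (rename (Equiv.swap i i') (S (w * Equiv.swap i i'))) = 1 := by
      rw [← hc, ← coeff_rename_mapDomain _ (Equiv.swap i i').injective, rename_rename]
      have : (⇑(Equiv.swap i i') ∘ ⇑(Equiv.swap i i')) = id := by ext; simp
      rw [this, rename_id_apply]
    have z3 : coeff m (X i * S w) = 0 := by
      rw [coeff_X_mul']
      split_ifs
      · apply coeff_eq_zero_of_lt _ i'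
        have := hg i'
        rw [Finsupp.tsub_apply, hmi', Finsupp.single_eq_of_ne hne.symm]
        omega
      · rfl
    have z4 : coeff m (X i' * S w) = coeff c (S w) := by
      rw [hm, coeff_X_mul]
    rw [sub_mul, coeff_sub, coeff_sub, z1, z2, z3, z4] at hE
    linarith

end helpers

/-- The coefficient of `x^{code(w)}` in the Schubert polynomial `𝔖_w` equals `1`
(in particular it is nonzero). -/
theorem stmt11 {n : ℕ} (S : Equiv.Perm (Fin n) → MvPolynomial (Fin n) ℤ)
    (hS : IsSchubertFamily S) (w : Equiv.Perm (Fin n)) :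
    coeff (Finsupp.equivFunOnFinite.symm (code w)) (S w) = 1 := by
  exact (main_aux S hS _ w rfl).2
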